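/- arXiv:1507.02370 — 2 statements merged into one kernel-verified Lean document; each statement's English description precedes it below -/
import Mathlib

section
/- Let K/F be a quadratic extension of number fields with Galois group G, S_F a finite set of primes of F containing all infinite primes, S_K the primes of K above S_F, and U_{K,S} the S_K-units of K. Then #H¹(G, U_{K,S}) = 2^{#S_K - 2#S_F + 1} · (U_{F,S} : N U_{K,S}), where N is the norm map from U_{K,S} to U_{F,S}. -/
open NumberField IsDedekindDomain

variable (F K : Type*) [Field F] [NumberField F] [Field K] [NumberField K]
  [Algebra F K] [IsGalois F K]

/-- The set of primes of `K` lying above the primes in `SF`. -/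
def SKset (SF : Finset (HeightOneSpectrum (𝓞 F))) : Set (HeightOneSpectrum (𝓞 K)) :=
  {w | ∃ v ∈ SF, w.asIdeal.comap (algebraMap (𝓞 F) (𝓞 K)) = v.asIdeal}

/-- `#S_F`, counting the finite primes in `S_F` together with all infinite primes of `F`
(which `S_F` always contains). -/
noncomputable def nSF (SF : Finset (HeightOneSpectrum (𝓞 F))) : ℕ :=
  SF.card + Nat.card (InfinitePlace F)

/-- `#S_K`, counting the finite primes of `K` above `S_F` together with all infinite
primes of `K`. -/
noncomputable def nSK (SF : Finset (HeightOneSpectrum (𝓞 F))) : ℕ :=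
  Nat.card (SKset F K SF) + Nat.card (InfinitePlace K)

/-- The action of `σ ∈ Gal(K/F)` on `Kˣ`. -/
def sigmaU (σ : K ≃ₐ[F] K) : Kˣ →* Kˣ := Units.map σ.toAlgHom.toRingHom.toMonoidHom

/-- The norm map `u ↦ u · σ(u)` on `Kˣ` (for `Gal(K/F) = {1, σ}`). -/
def normU (σ : K ≃ₐ[F] K) : Kˣ →* Kˣ := MonoidHom.id Kˣ * sigmaU F K σ

/-- The map `u ↦ u / σ(u)` on `Kˣ`. -/
def oneSubU (σ : K ≃ₐ[F] K) : Kˣ →* Kˣ := MonoidHom.id Kˣ / sigmaU F K σ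

/-- The subgroup of `Kˣ` fixed by the Galois group of `K/F`. -/
def fixedU : Subgroup Kˣ where
  carrier := {u | ∀ τ : K ≃ₐ[F] K, sigmaU F K τ u = u}
  one_mem' := fun τ => map_one _
  mul_mem' := fun ha hb τ => by rw [map_mul, ha τ, hb τ]
  inv_mem' := fun ha τ => by rw [map_inv, ha τ]

/-- The group `U_{K,S}` of `S_K`-units of `K`. -/
noncomputable def UKS (SF : Finset (HeightOneSpectrum (𝓞 F))) : Subgroup Kˣ :=
  (SKset F K SF).unit K

/-- The group `U_{F,S}` of `S_F`-units of `F`, realized inside `Kˣ` as the Galois-fixed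
`S_K`-units, via `U_{K,S}^G = U_{F,S}`. -/
noncomputable def UFS (SF : Finset (HeightOneSpectrum (𝓞 F))) : Subgroup Kˣ :=
  UKS F K SF ⊓ fixedU F K

/-- The subgroup `U_{K,S}⁻` of norm-one `S_K`-units. -/
noncomputable def UKSminus (σ : K ≃ₐ[F] K) (SF : Finset (HeightOneSpectrum (𝓞 F))) :
    Subgroup Kˣ :=
  UKS F K SF ⊓ (normU F K σ).ker

/-- The norm subgroup `N U_{K,S}`. -/
noncomputable def NUKS (σ : K ≃ₐ[F] K) (SF : Finset (HeightOneSpectrum (𝓞 F))) :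
    Subgroup Kˣ :=
  (UKS F K SF).map (normU F K σ)

/-- `#H¹(G, U_{K,S})` for `G = Gal(K/F) = {1, σ}` of order `2`, computed as
`#({u ∈ U_{K,S} : N u = 1} / {u/σ(u) : u ∈ U_{K,S}})`. -/
noncomputable def H1U (σ : K ≃ₐ[F] K) (SF : Finset (HeightOneSpectrum (𝓞 F))) : ℕ :=
  Nat.card (UKSminus F K σ SF ⧸
    (((UKS F K SF).map (oneSubU F K σ)).subgroupOf (UKSminus F K σ SF)))

/-- `#Ĥ⁰(G, U_{K,S}) = (U_{F,S} : N U_{K,S})`. -/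
noncomputable def H0U (σ : K ≃ₐ[F] K) (SF : Finset (HeightOneSpectrum (𝓞 F))) : ℕ :=
  Nat.card (UFS F K SF ⧸ ((NUKS F K σ SF).subgroupOf (UFS F K SF)))

/-- The Herbrand quotient `h(G, U_{K,S})`. -/
noncomputable def herbrandU (σ : K ≃ₐ[F] K) (SF : Finset (HeightOneSpectrum (𝓞 F))) : ℚ :=
  (H0U F K σ SF : ℚ) / (H1U F K σ SF : ℚ)

theorem AddSubgroup.index_range_nsmul_eq_pow_finrank_mul_card_ker (M : Type*) [AddCommGroup M]
    [Module.Finite ℤ M] {n : ℕ} (hn : n ≠ 0) :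
    (nsmulAddMonoidHom (α := M) n).range.index =
        n ^ Module.finrank ℤ M * Nat.card (nsmulAddMonoidHom (α := M) n).ker ∧
      Nat.card (nsmulAddMonoidHom (α := M) n).ker ≠ 0 := by
  set f := nsmulAddMonoidHom (α := M) n
  set T := (Submodule.torsion ℤ M).toAddSubgroup
  have hmem : ∀ x : M, n • x ∈ T → x ∈ T := by
    intro x hx
    obtain ⟨a, ha⟩ := hx
    refine ⟨⟨(a : ℤ) * n, mul_mem a.2 (mem_nonZeroDivisors_of_ne_zero (by exact_mod_cast hn))⟩, ?_⟩
    have : (a : ℤ) • (n • x) = 0 := ha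
    change ((a : ℤ) * (n : ℤ)) • x = 0
    rw [mul_smul, natCast_zsmul, this]
  have hTfin : Finite T := Module.finite_of_fg_torsion (Submodule.torsion ℤ M)
    Submodule.torsion_isTorsion
  have hker : f.ker ≤ T := fun x hx => hmem x (by
    have : n • x = 0 := hx
    rw [this]; exact T.zero_mem)
  have hfree : (T ⊔ f.range).index = n ^ Module.finrank ℤ M := by
    rw [← finrank_quotient_eq_of_le_torsion (R := ℤ) (M := M) le_rfl,
      ← AddSubgroup.index_range_nsmul]
    set q := (Submodule.torsion ℤ M).mkQ.toAddMonoidHom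
    have hq : Function.Surjective q := (Submodule.torsion ℤ M).mkQ_surjective
    rw [← AddSubgroup.index_comap_of_surjective _ hq]
    congr 1
    ext x
    rw [iff_comm, AddSubgroup.mem_comap, AddSubgroup.mem_sup]
    constructor
    · rintro ⟨y', hy'⟩
      obtain ⟨y, rfl⟩ := hq y'
      refine ⟨x - n • y, ?_, n • y, ⟨y, rfl⟩, sub_add_cancel _ _⟩
      refine (Submodule.Quotient.mk_eq_zero _).1 ?_
      change q (x - n • y) = 0
      rw [map_sub, map_nsmul, ← hy', sub_eq_zero]
      rfl
    · rintro ⟨t, ht, _, ⟨y, rfl⟩, rfl⟩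
      refine ⟨q y, ?_⟩
      have : q t = 0 := (Submodule.Quotient.mk_eq_zero _).2 ht
      rw [map_add, this, zero_add]
      exact (map_nsmul q n y).symm
  have htors : (f.range).relIndex (T ⊔ f.range) = Nat.card f.ker := by
    rw [AddSubgroup.relIndex_sup_right]
    have h1 : f.range.relIndex T = (T.map f).relIndex T := by
      rw [← AddSubgroup.inf_relIndex_right]
      congr 1
      ext x
      constructor
      · rintro ⟨⟨y, rfl⟩, hy⟩
        exact ⟨y, hmem y hy, rfl⟩
      · rintro ⟨y, hy, rfl⟩
        exact ⟨⟨y, rfl⟩, T.nsmul_mem hy n⟩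
    have h2 : (T.map f) ≤ T := by
      rintro _ ⟨y, hy, rfl⟩
      exact T.nsmul_mem hy n
    have h3 := AddSubgroup.relIndex_mul_relIndex ⊥ (T.map f) T bot_le h2
    have h4 := AddSubgroup.relIndex_mul_relIndex ⊥ f.ker T bot_le hker
    rw [AddSubgroup.relIndex_ker, AddSubgroup.relIndex_bot_left, AddSubgroup.relIndex_bot_left] at h4
    rw [AddSubgroup.relIndex_bot_left, AddSubgroup.relIndex_bot_left, ← h4, mul_comm] at h3
    rw [h1]
    have : Finite (T.map f) := Finite.of_surjective _ (f.addSubgroupMap_surjective T)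
    exact Nat.eq_of_mul_eq_mul_right Nat.card_pos h3
  have hkfin : Finite f.ker := Finite.of_injective _ (AddSubgroup.inclusion_injective hker)
  refine ⟨?_, Nat.card_pos.ne'⟩
  rw [← AddSubgroup.relIndex_mul_index (le_sup_right : f.range ≤ T ⊔ f.range), hfree, htors,
    mul_comm]

theorem Subgroup.index_range_powMonoidHom_eq_pow_finrank_mul_card_ker (G : Type*) [CommGroup G]
    [Module.Finite ℤ (Additive G)] {n : ℕ} (hn : n ≠ 0) :
    (powMonoidHom (α := G) n).range.index =
        n ^ Module.finrank ℤ (Additive G) * Nat.card (powMonoidHom (α := G) n).ker ∧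
      Nat.card (powMonoidHom (α := G) n).ker ≠ 0 :=
  AddSubgroup.index_range_nsmul_eq_pow_finrank_mul_card_ker (Additive G) hn

theorem Subgroup.relIndex_range_mul_index_sup_ker {A : Type*} [CommGroup A] (f g : A →* A)
    (hf : f.range ≤ g.ker) :
    f.range.relIndex g.ker * (g.ker ⊔ f.ker).index = (g.ker.map f).relIndex g.ker := by
  rw [← Subgroup.relIndex_mul_relIndex (g.ker.map f) f.range g.ker (Subgroup.map_le_range f _) hf,
    mul_comm, f.range_eq_map, Subgroup.relIndex_map_map, top_sup_eq, Subgroup.relIndex_top_right]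

theorem Subgroup.relIndex_map_eq_index_range_powMonoidHom {A : Type*} [CommGroup A] (f : A →* A)
    (H : Subgroup A) (n : ℕ) (hf : ∀ x ∈ H, f x = x ^ n) :
    (H.map f).relIndex H = (powMonoidHom (α := H) n).range.index := by
  rw [Subgroup.relIndex]
  congr 1
  ext ⟨x, hx⟩
  rw [Subgroup.mem_subgroupOf]
  constructor
  · rintro ⟨y, hy, hyx⟩
    exact ⟨⟨y, hy⟩, Subtype.ext ((hf y hy).symm.trans hyx)⟩
  · rintro ⟨⟨y, hy⟩, hyx⟩
    exact ⟨y, hy, (hf y hy).trans (congrArg Subtype.val hyx)⟩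

theorem finrank_ker_add_finrank_ker_of_eq_sq {A : Type*} [CommGroup A]
    [Module.Finite ℤ (Additive A)] (f g : A →* A) (hf : f.range ≤ g.ker)
    (hfg : ∀ x ∈ g.ker, f x = x ^ 2) :
    Module.finrank ℤ (Additive f.ker) + Module.finrank ℤ (Additive g.ker) =
      Module.finrank ℤ (Additive A) := by
  set φ := f.toAdditive.toIntLinearMap
  set ψ := g.toAdditive.toIntLinearMap
  have hle : φ.range ≤ ψ.ker := by
    rintro _ ⟨x, rfl⟩
    exact hf ⟨x.toMul, rfl⟩
  have h1 : Module.finrank ℤ φ.range + Module.finrank ℤ φ.ker = Module.finrank ℤ (Additive A) := by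
    rw [← Submodule.finrank_quotient_add_finrank φ.ker, φ.quotKerEquivRange.finrank_eq]
  have h2 : Module.finrank ℤ ψ.ker ≤ Module.finrank ℤ φ.range := by
    set θ := φ.rangeRestrict ∘ₗ ψ.ker.subtype
    have hθ : Module.finrank ℤ θ.ker = 0 := by
      rw [Module.finrank_eq_zero_iff_isTorsion]
      rintro ⟨⟨x, hx⟩, hθx⟩
      refine ⟨⟨2, mem_nonZeroDivisors_of_ne_zero two_ne_zero⟩, Subtype.ext (Subtype.ext ?_)⟩
      have h0 : f x.toMul = 1 := congrArg Subtype.val hθx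
      rw [hfg x.toMul hx, sq] at h0
      change (2 : ℤ) • x = 0
      rw [two_smul]
      exact h0
    rw [← θ.ker.finrank_quotient_add_finrank, hθ, add_zero, θ.quotKerEquivRange.finrank_eq]
    exact θ.range.finrank_le
  have h3 := Submodule.finrank_mono hle
  change Module.finrank ℤ φ.ker + Module.finrank ℤ ψ.ker = _
  omega

theorem herbrand_quotient_of_involution {A : Type*} [CommGroup A]
    [Module.Finite ℤ (Additive A)] (s : A →* A) (hs : ∀ x, s (s x) = x) :
    (((MonoidHom.id A / s).range.relIndex (MonoidHom.id A * s).ker : ℕ) : ℚ) =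
      (2 : ℚ) ^ ((Module.finrank ℤ (Additive A) : ℤ) -
        2 * Module.finrank ℤ (Additive (MonoidHom.id A / s).ker)) *
      ((MonoidHom.id A * s).range.relIndex (MonoidHom.id A / s).ker : ℕ) := by
  set N := MonoidHom.id A * s
  set D := MonoidHom.id A / s
  have hNx : ∀ x, N x = x * s x := fun x => rfl
  have hDx : ∀ x, D x = x / s x := fun x => rfl
  have mem_N : ∀ x, x ∈ N.ker ↔ s x = x⁻¹ := fun x => by
    rw [MonoidHom.mem_ker, hNx, mul_eq_one_iff_inv_eq, eq_comm]
  have mem_D : ∀ x, x ∈ D.ker ↔ s x = x := fun x => by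
    rw [MonoidHom.mem_ker, hDx, div_eq_one, eq_comm]
  have hND : N.range ≤ D.ker := by
    rintro _ ⟨x, rfl⟩
    rw [mem_D, hNx, map_mul, hs, mul_comm]
  have hDN : D.range ≤ N.ker := by
    rintro _ ⟨x, rfl⟩
    rw [mem_N, hDx, map_div, hs, inv_div]
  have hNsq : ∀ x ∈ D.ker, N x = x ^ 2 := fun x hx => by
    rw [hNx, (mem_D x).1 hx, sq]
  have hDsq : ∀ x ∈ N.ker, D x = x ^ 2 := fun x hx => by
    rw [hDx, (mem_N x).1 hx, div_inv_eq_mul, sq]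
  have hrank := finrank_ker_add_finrank_ker_of_eq_sq N D hND hNsq
  have hfin (H : Subgroup A) : Module.Finite ℤ (Additive H) :=
    inferInstanceAs (Module.Finite ℤ (AddSubgroup.toIntSubmodule H.toAddSubgroup))
  have hH0 := Subgroup.relIndex_range_mul_index_sup_ker N D hND
  have hH1 := Subgroup.relIndex_range_mul_index_sup_ker D N hDN
  rw [Subgroup.relIndex_map_eq_index_range_powMonoidHom _ _ 2 ‹_›,
    (Subgroup.index_range_powMonoidHom_eq_pow_finrank_mul_card_ker _ two_ne_zero).1] at hH0 hH1
  obtain ⟨_, ht⟩ := Subgroup.index_range_powMonoidHom_eq_pow_finrank_mul_card_ker D.ker two_ne_zero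
  have htt : Nat.card (powMonoidHom (α := N.ker) 2).ker =
      Nat.card (powMonoidHom (α := D.ker) 2).ker := by
    have hinv : ∀ x : A, x ^ 2 = 1 → x⁻¹ = x := fun x hx => by
      rw [inv_eq_iff_mul_eq_one, ← sq, hx]
    have key : ∀ H : Subgroup A, Nat.card (powMonoidHom (α := H) 2).ker =
        Nat.card ((powMonoidHom (α := A) 2).ker ⊓ H : Subgroup A) := fun H => by
      rw [← Subgroup.subgroupOf_map_subtype, Subgroup.card_subtype]
      congr! 2
      ext x
      simp [Subgroup.mem_subgroupOf, MonoidHom.mem_ker, Subtype.ext_iff]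
    rw [key, key]
    congr! 2
    ext x
    simp only [Subgroup.mem_inf, mem_N, mem_D]
    refine and_congr_right fun hx => ?_
    rw [hinv x hx]
  rw [htt] at hH1
  rw [sup_comm] at hH1
  set t := Nat.card (powMonoidHom (α := D.ker) 2).ker
  set m := (D.ker ⊔ N.ker).index
  have hm : (m : ℚ) ≠ 0 := by
    intro hm
    rw [Nat.cast_eq_zero.1 hm, mul_zero] at hH0
    exact mul_ne_zero (by positivity) ht hH0.symm
  apply mul_right_cancel₀ hm
  rw [mul_assoc, ← Nat.cast_mul, ← Nat.cast_mul, hH0, hH1, ← hrank]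
  push_cast
  rw [← mul_assoc, ← zpow_natCast, ← zpow_natCast, ← zpow_add₀ two_ne_zero]
  congr 2
  ring

theorem exists_mem_unit_insert_valuationOfNeZero_ne_one (L : Type*) [Field L] [NumberField L]
    (S : Set (HeightOneSpectrum (𝓞 L))) (v : HeightOneSpectrum (𝓞 L)) :
    ∃ x ∈ (insert v S).unit L, v.valuationOfNeZero x ≠ 1 := by
  set h := Fintype.card (ClassGroup (𝓞 L))
  have hv0 : v.asIdeal ∈ nonZeroDivisors (Ideal (𝓞 L)) := mem_nonZeroDivisors_of_ne_zero v.ne_bot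
  have hpr : (v.asIdeal ^ h).IsPrincipal := by
    have := pow_card_eq_one (x := ClassGroup.mk0 ⟨v.asIdeal, hv0⟩)
    rw [← map_pow, ClassGroup.mk0_eq_one_iff] at this
    exact this
  obtain ⟨a, ha⟩ := hpr
  rw [Ideal.submodule_span_eq] at ha
  have hh : h ≠ 0 := Fintype.card_ne_zero
  have ha0 : a ≠ 0 := by
    rintro rfl
    rw [Ideal.span_singleton_eq_bot.2 rfl] at ha
    exact pow_ne_zero h v.ne_bot ha
  have haL : algebraMap (𝓞 L) L a ≠ 0 := by simpa using ha0
  refine ⟨Units.mk0 _ haL, fun w hw => ?_, fun hx => ?_⟩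
  · rw [Units.val_mk0, HeightOneSpectrum.valuation_eq_one_iff_notMem]
    intro haw
    have hle : v.asIdeal ^ h ≤ w.asIdeal := by
      rw [ha, Ideal.span_singleton_le_iff_mem]
      exact haw
    have hle' : v.asIdeal ≤ w.asIdeal := w.isPrime.le_of_pow_le hle
    refine hw (Or.inl (HeightOneSpectrum.ext ?_))
    exact (v.isMaximal.eq_of_le w.isPrime.ne_top hle').symm
  · have hav : a ∈ v.asIdeal := Ideal.pow_le_self hh (ha ▸ Ideal.mem_span_singleton_self a)
    have := (v.valuation_lt_one_iff_mem (K := L) a).2 hav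
    change v.valuation L (Units.mk0 _ haL : L) < 1 at this
    rw [← HeightOneSpectrum.valuationOfNeZero_eq, hx] at this
    exact lt_irrefl _ this

theorem finite_and_finrank_unit_insert (L : Type*) [Field L] [NumberField L]
    (S : Set (HeightOneSpectrum (𝓞 L))) (v : HeightOneSpectrum (𝓞 L)) (hv : v ∉ S)
    [Module.Finite ℤ (Additive (S.unit L))] :
    Module.Finite ℤ (Additive ((insert v S).unit L)) ∧
      Module.finrank ℤ (Additive ((insert v S).unit L)) =
        Module.finrank ℤ (Additive (S.unit L)) + 1 := by
  set φ : Additive ((insert v S).unit L) →ₗ[ℤ] ℤ :=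
    (MonoidHom.toAdditiveLeft
      ((v.valuationOfNeZero (K := L)).comp ((insert v S).unit L).subtype)).toIntLinearMap
  have hle : S.unit L ≤ (insert v S).unit L := fun x hx w hw => hx w fun h => hw (Or.inr h)
  set ι := (Subgroup.inclusion hle).toAdditive.toIntLinearMap
  have hι : Function.Injective ι := Subgroup.inclusion_injective hle
  have hrange : ι.range = φ.ker := by
    ext x
    constructor
    · rintro ⟨y, rfl⟩
      have h1 : v.valuation L (y.toMul : Lˣ) = 1 := y.toMul.2 v hv
      rw [← HeightOneSpectrum.valuationOfNeZero_eq] at h1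
      exact WithZero.coe_inj.1 h1
    · intro hx
      have hx' : v.valuationOfNeZero (x.toMul : Lˣ) = 1 := hx
      refine ⟨Additive.ofMul ⟨x.toMul, fun w hw => ?_⟩, rfl⟩
      by_cases hwv : w = v
      · rw [hwv, ← HeightOneSpectrum.valuationOfNeZero_eq, hx', WithZero.coe_one]
      · exact x.toMul.2 w fun h => h.elim hwv hw
  set e : Additive (S.unit L) ≃ₗ[ℤ] φ.ker := (LinearEquiv.ofInjective ι hι).trans
    (LinearEquiv.ofEq _ _ hrange)
  have hker : Module.Finite ℤ φ.ker := Module.Finite.equiv e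
  have hquot : Module.Finite ℤ (_ ⧸ φ.ker) := Module.Finite.equiv φ.quotKerEquivRange.symm
  have hfin : Module.Finite ℤ (Additive ((insert v S).unit L)) :=
    Module.Finite.of_submodule_quotient φ.ker
  refine ⟨hfin, ?_⟩
  rw [← φ.ker.finrank_quotient_add_finrank, φ.quotKerEquivRange.finrank_eq, e.finrank_eq, add_comm]
  congr 1
  apply le_antisymm
  · exact (Submodule.finrank_le _).trans_eq (Module.finrank_self ℤ)
  · obtain ⟨x, hx, hvx⟩ := exists_mem_unit_insert_valuationOfNeZero_ne_one L S v
    have : Nontrivial φ.range := by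
      rw [Submodule.nontrivial_iff_ne_bot]
      intro h
      refine hvx ?_
      have : φ (Additive.ofMul ⟨x, hx⟩) ∈ φ.range := ⟨_, rfl⟩
      rw [h, Submodule.mem_bot] at this
      exact this
    exact Module.finrank_pos

theorem finite_and_finrank_unit (L : Type*) [Field L] [NumberField L]
    (S : Set (HeightOneSpectrum (𝓞 L))) (hS : S.Finite) :
    Module.Finite ℤ (Additive (S.unit L)) ∧
      Module.finrank ℤ (Additive (S.unit L)) + 1 =
        Nat.card S + Nat.card (InfinitePlace L) := by
  induction S, hS using Set.Finite.induction_on with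
  | empty =>
    set e : Additive ((∅ : Set (HeightOneSpectrum (𝓞 L))).unit L) ≃ₗ[ℤ] Additive (𝓞 L)ˣ :=
      (MulEquiv.toAdditive (((∅ : Set (HeightOneSpectrum (𝓞 L))).unitEquivUnitsInteger L).trans
        (Units.mapEquiv ((Subalgebra.equivOfEq _ _ (integer_empty (𝓞 L) L)).trans
          (Algebra.botEquivOfInjective
            (RingOfIntegers.coe_injective))).toMulEquiv))).toIntLinearEquiv
    refine ⟨Module.Finite.equiv e.symm, ?_⟩
    rw [e.finrank_eq, Units.finrank_eq, Units.rank, Nat.card_of_isEmpty, zero_add, Nat.card_eq_fintype_card]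
    exact Nat.sub_add_cancel Fintype.card_pos
  | @insert v S hv hS ih =>
    obtain ⟨h1, h2⟩ := ih
    obtain ⟨h3, h4⟩ := finite_and_finrank_unit_insert L S v hv
    refine ⟨h3, ?_⟩
    rw [h4, h2, Nat.card_coe_set_eq, Nat.card_coe_set_eq, Set.ncard_insert_of_notMem hv hS]
    ring

theorem valuation_apply_ringEquiv_le_one {L : Type*} [Field L] [NumberField L] (e : L ≃+* L)
    (w : HeightOneSpectrum (𝓞 L)) {x : L}
    (hx : (w.comap (RingOfIntegers.mapRingEquiv e : 𝓞 L →+* 𝓞 L)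
      (RingOfIntegers.mapRingEquiv e).surjective).valuation L x ≤ 1) :
    w.valuation L (e x) ≤ 1 := by
  obtain ⟨n, d, hnd⟩ := HeightOneSpectrum.exists_primeCompl_mul_eq_of_integer _ x hx
  have hd : w.valuation L (e (algebraMap (𝓞 L) L d)) = 1 :=
    (w.valuation_eq_one_iff_notMem (K := L)
      (r := RingOfIntegers.mapRingEquiv e (d : 𝓞 L))).2 d.2
  have hn : w.valuation L (e (algebraMap (𝓞 L) L n)) ≤ 1 :=
    w.valuation_le_one (K := L) (RingOfIntegers.mapRingEquiv e n)
  rwa [← hnd, map_mul, map_mul, hd, mul_one] at hn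

section Quadratic

set_option linter.unusedSectionVars false

variable {F K}

theorem finite_SKset (SF : Finset (HeightOneSpectrum (𝓞 F))) : (SKset F K SF).Finite := by
  have : SKset F K SF = ⋃ v ∈ SF, HeightOneSpectrum.asIdeal ⁻¹' (v.asIdeal.primesOver (𝓞 K)) := by
    ext w
    simp only [SKset, Set.mem_ofPred_eq, Set.mem_iUnion, Set.mem_preimage]
    constructor
    · rintro ⟨v, hv, h⟩
      exact ⟨v, hv, w.isPrime, ⟨h.symm⟩⟩
    · rintro ⟨v, hv, _, h⟩
      exact ⟨v, hv, h.over.symm⟩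
  rw [this]
  refine Set.Finite.biUnion SF.finite_toSet fun v _ => ?_
  exact (Algebra.QuasiFinite.finite_primesOver v.asIdeal).preimage
    HeightOneSpectrum.asIdeal_injective.injOn

theorem sigmaU_mem_UKS (σ : K ≃ₐ[F] K) (SF : Finset (HeightOneSpectrum (𝓞 F))) {x : Kˣ}
    (hx : x ∈ UKS F K SF) : sigmaU F K σ x ∈ UKS F K SF := by
  intro w hw
  have hw' : w.comap (RingOfIntegers.mapRingEquiv (σ : K ≃+* K) : 𝓞 K →+* 𝓞 K)
      (RingOfIntegers.mapRingEquiv (σ : K ≃+* K)).surjective ∉ SKset F K SF := by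
    rintro ⟨v, hv, h⟩
    refine hw ⟨v, hv, Eq.trans (Ideal.ext fun a => ?_) h⟩
    have ha : RingOfIntegers.mapRingEquiv (σ : K ≃+* K) (algebraMap (𝓞 F) (𝓞 K) a) =
        algebraMap (𝓞 F) (𝓞 K) a := RingOfIntegers.ext (σ.commutes (a : F))
    exact iff_of_eq (congrArg (· ∈ w.asIdeal) ha.symm)
  have h1 := valuation_apply_ringEquiv_le_one (σ : K ≃+* K) w (hx _ hw').le
  have h2 := valuation_apply_ringEquiv_le_one (σ : K ≃+* K) w
    ((UKS F K SF).inv_mem hx _ hw').le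
  rw [Units.val_inv_eq_inv_val, map_inv₀, map_inv₀] at h2
  refine le_antisymm h1 ((inv_le_one₀ ?_).1 h2)
  exact zero_lt_iff.2 ((Valuation.ne_zero_iff _).2 (sigmaU F K σ x).ne_zero)

theorem map_algebraMap_unit_eq_UFS (SF : Finset (HeightOneSpectrum (𝓞 F))) :
    ((SF : Set (HeightOneSpectrum (𝓞 F))).unit F).map (Units.map (algebraMap F K : F →* K)) =
      UFS F K SF := by
  ext x
  constructor
  · rintro ⟨y, hy, rfl⟩
    refine ⟨fun w hw => ?_, fun τ => Units.ext (τ.commutes _)⟩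
    have hbot : w.asIdeal.comap (algebraMap (𝓞 F) (𝓞 K)) ≠ ⊥ :=
      mt Ideal.eq_bot_of_comap_eq_bot w.ne_bot
    let v : HeightOneSpectrum (𝓞 F) := ⟨_, Ideal.comap_isPrime _ w.asIdeal, hbot⟩
    have : w.asIdeal.LiesOver v.asIdeal := ⟨rfl⟩
    have hv : v ∉ (SF : Set (HeightOneSpectrum (𝓞 F))) := fun hv => hw ⟨v, hv, rfl⟩
    have hval := HeightOneSpectrum.valuation_liesOver K v w (y : F)
    rw [hy v hv, one_pow] at hval
    exact hval.symm
  · rintro ⟨hx, hfix⟩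
    obtain ⟨y, hy⟩ := (IsGalois.mem_range_algebraMap_iff_fixed (F := F) (x : K)).2
      fun τ => congrArg Units.val (hfix τ)
    have hy0 : y ≠ 0 := by
      rintro rfl
      exact x.ne_zero (by rw [← hy, map_zero])
    refine ⟨Units.mk0 y hy0, fun v hv => ?_, Units.ext hy⟩
    obtain ⟨Q, hQ, hQv⟩ := Ideal.nonempty_primesOver (S := 𝓞 K) v.asIdeal
    let w : HeightOneSpectrum (𝓞 K) :=
      ⟨Q, hQ, Ideal.ne_bot_of_liesOver_of_ne_bot v.ne_bot Q⟩
    have hw : w ∉ SKset F K SF := by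
      rintro ⟨v', hv', h⟩
      have : v' = v := HeightOneSpectrum.ext (h.symm.trans hQv.over.symm)
      exact hv (this ▸ hv')
    have : w.asIdeal.LiesOver v.asIdeal := hQv
    have hval := HeightOneSpectrum.valuation_liesOver K v w y
    rw [hy, hx w hw] at hval
    exact (pow_eq_one_iff_of_nonneg zero_le
      (Ideal.IsDedekindDomain.ramificationIdx'_ne_zero_of_liesOver w.asIdeal v.ne_bot)).1 hval

theorem eq_one_or_eq_of_finrank_eq_two (hd : Module.finrank F K = 2) {σ : K ≃ₐ[F] K}
    (hσ : σ ≠ AlgEquiv.refl) (τ : K ≃ₐ[F] K) : τ = 1 ∨ τ = σ := by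
  have hcard : Nat.card (K ≃ₐ[F] K) = 2 := (IsGalois.card_aut_eq_finrank F K).trans hd
  have := (Nat.card_eq_two_iff' (1 : K ≃ₐ[F] K)).1 hcard
  by_contra! h
  exact h.2 (this.unique h.1 hσ)

end Quadratic

/-- For a quadratic extension `K/F` of number fields with
`Gal(K/F) = {1, σ}`, `#H¹(G, U_{K,S}) = 2^{#S_K - 2#S_F + 1} · (U_{F,S} : N U_{K,S})`. -/
theorem h1_card_sunits_eq_two_zpow_mul_index
    (hd : Module.finrank F K = 2) (σ : K ≃ₐ[F] K) (hσ : σ ≠ AlgEquiv.refl)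
    (SF : Finset (HeightOneSpectrum (𝓞 F))) :
    (H1U F K σ SF : ℚ) =
      (2 : ℚ) ^ ((nSK F K SF : ℤ) - 2 * (nSF F SF : ℤ) + 1) * (H0U F K σ SF : ℚ) := by
  have hgal := eq_one_or_eq_of_finrank_eq_two hd hσ
  have hσσ : ∀ x, σ (σ x) = x := by
    intro x
    rcases hgal (σ * σ) with h | h
    · exact DFunLike.congr_fun h x
    · exact absurd (mul_eq_left.1 h) hσ
  set U := UKS F K SF
  let s : U →* U := ((sigmaU F K σ).comp U.subtype).codRestrict U
    fun x => sigmaU_mem_UKS σ SF x.2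
  have hs : ∀ x, s (s x) = x := fun x => Subtype.ext (Units.ext (hσσ _))
  have hfixed : ∀ x, x ∈ fixedU F K ↔ sigmaU F K σ x = x := by
    refine fun x => ⟨fun h => h σ, fun h τ => ?_⟩
    rcases hgal τ with rfl | rfl
    · rfl
    · exact h
  obtain ⟨hfin, hrank⟩ : Module.Finite ℤ (Additive U) ∧
      Module.finrank ℤ (Additive U) + 1 = nSK F K SF :=
    finite_and_finrank_unit K (SKset F K SF) (finite_SKset SF)
  have main := herbrand_quotient_of_involution s hs
  have hN : (MonoidHom.id U * s).ker.map U.subtype = UKSminus F K σ SF := by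
    ext x
    constructor
    · rintro ⟨y, hy, rfl⟩
      exact ⟨y.2, congrArg Subtype.val hy⟩
    · rintro ⟨hxU, hx⟩
      exact ⟨⟨x, hxU⟩, Subtype.ext hx, rfl⟩
  have hD : (MonoidHom.id U / s).ker.map U.subtype = UFS F K SF := by
    ext x
    constructor
    · rintro ⟨y, hy, rfl⟩
      exact ⟨y.2, (hfixed _).2 (div_eq_one.1 (congrArg Subtype.val hy)).symm⟩
    · rintro ⟨hxU, hx⟩
      exact ⟨⟨x, hxU⟩, Subtype.ext (div_eq_one.2 ((hfixed x).1 hx).symm), rfl⟩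
  have hNr : (MonoidHom.id U * s).range.map U.subtype = NUKS F K σ SF := by
    rw [MonoidHom.map_range]
    ext x
    constructor
    · rintro ⟨y, rfl⟩
      exact ⟨y, y.2, rfl⟩
    · rintro ⟨y, hy, rfl⟩
      exact ⟨⟨y, hy⟩, rfl⟩
  have hDr : (MonoidHom.id U / s).range.map U.subtype = U.map (oneSubU F K σ) := by
    rw [MonoidHom.map_range]
    ext x
    constructor
    · rintro ⟨y, rfl⟩
      exact ⟨y, y.2, rfl⟩
    · rintro ⟨y, hy, rfl⟩
      exact ⟨⟨y, hy⟩, rfl⟩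
  rw [← Subgroup.relIndex_map_map_of_injective _ _ U.subtype_injective,
    ← Subgroup.relIndex_map_map_of_injective _ _ U.subtype_injective, hN, hD, hNr, hDr] at main
  obtain ⟨-, hrankF⟩ := finite_and_finrank_unit F (SF : Set (HeightOneSpectrum (𝓞 F)))
    SF.finite_toSet
  have hrankD : Module.finrank ℤ (Additive (MonoidHom.id U / s).ker) =
      Module.finrank ℤ (Additive ((SF : Set (HeightOneSpectrum (𝓞 F))).unit F)) := by
    let e := ((MonoidHom.id U / s).ker.equivMapOfInjective _ U.subtype_injective).trans
      ((MulEquiv.subgroupCongr (hD.trans (map_algebraMap_unit_eq_UFS SF).symm)).trans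
        (Subgroup.equivMapOfInjective _ _
          (Units.map_injective (algebraMap F K).injective)).symm)
    exact (MulEquiv.toAdditive e).toIntLinearEquiv.finrank_eq
  have hexp : (Module.finrank ℤ (Additive U) : ℤ) -
      2 * Module.finrank ℤ (Additive (MonoidHom.id U / s).ker) =
      (nSK F K SF : ℤ) - 2 * (nSF F SF : ℤ) + 1 := by
    rw [hrankD]
    have : Module.finrank ℤ (Additive ((SF : Set (HeightOneSpectrum (𝓞 F))).unit F)) + 1 =
        nSF F SF := by
      rw [hrankF, nSF, Nat.card_coe_set_eq, Set.ncard_coe_finset]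
    omega
  rw [hexp] at main
  exact main
end

section
/- Let K/F be a quadratic extension of number fields with Galois group G. Then the Herbrand quotient h(G, U_{K,S}) = 2^{2#S_F - #S_K - 1}. -/
open NumberField IsDedekindDomain

variable (F K : Type*) [Field F] [NumberField F] [Field K] [NumberField K]
  [Algebra F K] [IsGalois F K]

namespace AddCommGroup

lemma finrank_int_prod_of_finite (M T : Type*) [AddCommGroup M] [AddCommGroup T] [Finite T]
    [Module.Free ℤ M] [Module.Finite ℤ M] :
    Module.finrank ℤ (M × T) = Module.finrank ℤ M := by
  have hT : Module.finrank ℤ (LinearMap.ker (LinearMap.fst ℤ M T)) = 0 := by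
    rw [Module.finrank_eq_zero_iff_isTorsion]
    rintro ⟨⟨m, t⟩, hm⟩
    obtain rfl : m = 0 := hm
    refine ⟨⟨(Nat.card T : ℤ), by simp [Nat.card_pos.ne']⟩, ?_⟩
    ext <;> simp [Submonoid.smul_def]
  have h := (LinearMap.ker (LinearMap.fst ℤ M T)).finrank_quotient_add_finrank
  rw [hT, ((LinearMap.fst ℤ M T).quotKerEquivOfSurjective Prod.fst_surjective).finrank_eq] at h
  exact h.symm

/-- In a finitely generated abelian group `A`, `#(A / nA) = n ^ rank A * #A[n]`. -/
lemma index_range_nsmul (A : Type*) [AddCommGroup A] [Module.Finite ℤ A] {n : ℕ} (hn : n ≠ 0) :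
    (nsmulAddMonoidHom (α := A) n).range.index =
      n ^ Module.finrank ℤ A * Nat.card (nsmulAddMonoidHom (α := A) n).ker := by
  have : AddGroup.FG A := Module.Finite.iff_addGroup_fg.mp inferInstance
  obtain ⟨r, ι, _, p, hp, e, ⟨φ⟩⟩ := AddCommGroup.equiv_free_prod_directSum_zmod A
  set T := DirectSum ι fun i => ZMod (p i ^ e i)
  have (i : ι) : NeZero (p i ^ e i) := ⟨pow_ne_zero _ (hp i).ne_zero⟩
  have : Finite T := by
    classical
    exact Finite.of_equiv _ (DirectSum.addEquivProd fun i => ZMod (p i ^ e i)).symm.toEquiv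
  have hrange : (nsmulAddMonoidHom (α := A) n).range.index =
      (nsmulAddMonoidHom (α := (Fin r →₀ ℤ) × T) n).range.index := by
    rw [← AddSubgroup.index_map_equiv _ φ]
    congr 1
    exact AddEquiv.map_range_nsmulAddMonoidHom φ n
  have hprod : (nsmulAddMonoidHom (α := (Fin r →₀ ℤ) × T) n).range =
      (nsmulAddMonoidHom (α := Fin r →₀ ℤ) n).range.prod (nsmulAddMonoidHom (α := T) n).range := by
    ext ⟨x, t⟩
    simp [AddSubgroup.mem_prod, Prod.ext_iff]
  have hT : (nsmulAddMonoidHom (α := T) n).range.index =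
      Nat.card (nsmulAddMonoidHom (α := T) n).ker := by
    have h1 := (nsmulAddMonoidHom (α := T) n).ker.card_mul_index
    have h2 := (nsmulAddMonoidHom (α := T) n).range.card_mul_index
    rw [AddSubgroup.index_ker, mul_comm] at h1
    exact Nat.eq_of_mul_eq_mul_left Nat.card_pos (h2.trans h1.symm)
  have hker : Nat.card (nsmulAddMonoidHom (α := A) n).ker =
      Nat.card (nsmulAddMonoidHom (α := T) n).ker := by
    refine Nat.card_congr ⟨fun x => ⟨(φ x).2, ?_⟩, fun t => ⟨φ.symm (0, t), ?_⟩, ?_, ?_⟩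
    · have := congrArg (fun y => (φ y).2) x.2
      simpa using this
    · have := t.2
      simp only [AddMonoidHom.mem_ker, nsmulAddMonoidHom_apply] at this ⊢
      rw [← map_nsmul, Prod.smul_mk, this]
      simp
    · rintro ⟨x, hx⟩
      have := congrArg (fun y => (φ y).1) hx
      simp only [nsmulAddMonoidHom_apply, map_nsmul, Prod.smul_fst, map_zero, Prod.fst_zero,
        smul_eq_zero, hn, false_or] at this
      ext
      simp [← this]
    · rintro ⟨t, ht⟩
      simp
  rw [hrange, hprod, AddSubgroup.index_prod, AddSubgroup.index_range_nsmul, hT, hker,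
    φ.toIntLinearEquiv.finrank_eq, finrank_int_prod_of_finite]

end AddCommGroup

namespace Subgroup

variable {V W : Type*} [CommGroup V] [CommGroup W]

/-- A subgroup of a commutative group, as a `ℤ`-submodule of the additive version of the group. -/
abbrev toIntSubmodule (B : Subgroup V) : Submodule ℤ (Additive V) :=
  AddSubgroup.toIntSubmodule (Subgroup.toAddSubgroup B)

/-- The free rank of a subgroup of a commutative group. -/
noncomputable def intRank (B : Subgroup V) : ℕ := Module.finrank ℤ B.toIntSubmodule

lemma intRank_mono {B C : Subgroup V} (h : B ≤ C) (hC : C.toIntSubmodule.FG) :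
    B.intRank ≤ C.intRank := by
  have : Module.Finite ℤ C.toIntSubmodule := Module.Finite.iff_fg.mpr hC
  exact Submodule.finrank_mono (R := ℤ) (M := Additive V) h

lemma fg_toIntSubmodule_mono {B C : Subgroup V} (h : B ≤ C) (hC : C.toIntSubmodule.FG) :
    B.toIntSubmodule.FG :=
  Submodule.FG.of_le hC h

lemma fg_toIntSubmodule_map {B : Subgroup V} (f : V →* W) (hB : B.toIntSubmodule.FG) :
    (B.map f).toIntSubmodule.FG :=
  Submodule.FG.map f.toAdditive.toIntLinearMap hB

lemma fg_toIntSubmodule_of_map {B : Subgroup V} (f : V →* W)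
    (h : (B.map f).toIntSubmodule.FG) (hk : (B ⊓ f.ker).toIntSubmodule.FG) :
    B.toIntSubmodule.FG :=
  Submodule.fg_of_fg_map_of_fg_inf_ker f.toAdditive.toIntLinearMap h hk

lemma intRank_map_add (f : V →* W) {B : Subgroup V} (hB : B.toIntSubmodule.FG) :
    (B.map f).intRank + (B ⊓ f.ker).intRank = B.intRank := by
  have : Module.Finite ℤ B.toIntSubmodule := Module.Finite.iff_fg.mpr hB
  let g := f.toAdditive.toIntLinearMap.domRestrict B.toIntSubmodule
  have h := g.ker.finrank_quotient_add_finrank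
  rw [g.quotKerEquivRange.finrank_eq] at h
  have hr : g.range = (B.map f).toIntSubmodule := by
    rw [LinearMap.range_domRestrict]; rfl
  have hk : Submodule.map B.toIntSubmodule.subtype g.ker = (B ⊓ f.ker).toIntSubmodule := by
    ext x
    constructor
    · rintro ⟨y, hy, rfl⟩
      exact ⟨y.2, hy⟩
    · rintro ⟨hx, hy⟩
      exact ⟨⟨x, hx⟩, hy, rfl⟩
  rw [hr, ← Submodule.finrank_map_subtype_eq, hk] at h
  exact h

lemma intRank_eq_zero_of_forall_pow_eq_one {B : Subgroup V} {n : ℕ} (hn : n ≠ 0)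
    (h : ∀ x ∈ B, x ^ n = 1) (hB : B.toIntSubmodule.FG) : B.intRank = 0 := by
  have : Module.Finite ℤ B.toIntSubmodule := Module.Finite.iff_fg.mpr hB
  rw [intRank, Module.finrank_eq_zero_iff_isTorsion]
  rintro ⟨x, hx⟩
  refine ⟨⟨(n : ℤ), by simpa using hn⟩, Subtype.ext ?_⟩
  rw [Submonoid.mk_smul, natCast_zsmul]
  change n • x = 0
  exact h x hx

lemma intRank_map_of_injective {f : V →* W} (hf : Function.Injective f) {B : Subgroup V}
    (hB : B.toIntSubmodule.FG) : (B.map f).intRank = B.intRank := by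
  rw [← intRank_map_add f hB, (MonoidHom.ker_eq_bot_iff f).mpr hf, inf_bot_eq,
    intRank_eq_zero_of_forall_pow_eq_one one_ne_zero (by simp)
      (fg_toIntSubmodule_mono bot_le hB), add_zero]

lemma intRank_map_powMonoidHom {n : ℕ} (hn : n ≠ 0) {B : Subgroup V}
    (hB : B.toIntSubmodule.FG) : (B.map (powMonoidHom n)).intRank = B.intRank := by
  rw [← intRank_map_add (powMonoidHom n) hB,
    intRank_eq_zero_of_forall_pow_eq_one (B := B ⊓ (powMonoidHom n : V →* V).ker) hn
      (fun x hx => hx.2) (fg_toIntSubmodule_mono inf_le_left hB), add_zero]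

lemma relIndex_map_powMonoidHom {n : ℕ} (hn : n ≠ 0) {B : Subgroup V}
    (hB : B.toIntSubmodule.FG) :
    (B.map (powMonoidHom n)).relIndex B =
      n ^ B.intRank * Nat.card (B ⊓ (powMonoidHom n : V →* V).ker : Subgroup V) := by
  have : Module.Finite ℤ B.toIntSubmodule := Module.Finite.iff_fg.mpr hB
  have h := AddCommGroup.index_range_nsmul B.toIntSubmodule hn
  rw [relIndex, subgroupOf_map_powMonoidHom_eq_range]
  refine Eq.trans ?_ (h.trans ?_)
  · exact (Subgroup.index_toAddSubgroup (H := (powMonoidHom n : B →* B).range)).symm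
  · rw [intRank]
    congr 1
    refine Nat.card_congr ⟨fun x => ⟨x.1.1.toMul, x.1.2, congrArg Subtype.val x.2⟩,
      fun x => ⟨⟨Additive.ofMul x.1, x.2.1⟩, Subtype.ext x.2.2⟩, fun _ => rfl, fun _ => rfl⟩

lemma relIndex_map_powMonoidHom_ne_zero {n : ℕ} (hn : n ≠ 0) {B : Subgroup V}
    (hB : B.toIntSubmodule.FG) : (B.map (powMonoidHom n)).relIndex B ≠ 0 := by
  have : B.FG := (Subgroup.fg_iff_add_fg B).mpr (Submodule.fg_iff_addSubgroup_fg _ |>.mp hB)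
  exact (isFiniteRelIndex_map_powMonoidHom_of_fg this hn).relIndex_ne_zero

/-- For an involution `s` of a commutative group preserving a finitely generated subgroup `A`, with
fixed subgroup `P` and norm-one subgroup `Q`, the rank of `A` is the sum of the ranks of `P`
and `Q`. -/
lemma intRank_add_intRank_of_involution (s : V →* V) (hs : ∀ x, s (s x) = x) {A : Subgroup V}
    (hA : A.toIntSubmodule.FG) (hsA : A.map s ≤ A) :
    (A ⊓ (MonoidHom.id V / s).ker).intRank + (A ⊓ (MonoidHom.id V * s).ker).intRank =
      A.intRank := by
  rw [← intRank_map_add (MonoidHom.id V * s) hA]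
  congr 1
  set P := A ⊓ (MonoidHom.id V / s).ker
  have hP : P.toIntSubmodule.FG := fg_toIntSubmodule_mono inf_le_left hA
  have hPfix : ∀ x ∈ P, s x = x := fun x hx => (div_eq_one.mp hx.2).symm
  refine le_antisymm ?_ ?_
  · rw [← intRank_map_powMonoidHom two_ne_zero hP]
    refine intRank_mono ?_ (fg_toIntSubmodule_map _ hA)
    rintro _ ⟨x, hx, rfl⟩
    exact ⟨x, hx.1, by simp [hPfix x hx, pow_two]⟩
  · refine intRank_mono ?_ hP
    rintro _ ⟨x, hx, rfl⟩
    refine ⟨A.mul_mem hx (hsA ⟨x, hx, rfl⟩), ?_⟩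
    simp [hs, mul_comm]

lemma relIndex_map_map_of_le {P A : Subgroup V} (f : V →* W) (hPA : P ≤ A) :
    (P.map f).relIndex (A.map f) = (P ⊔ A ⊓ f.ker).relIndex A := by
  have h : A ⊔ f.ker = A ⊔ (P ⊔ f.ker) := by rw [← sup_assoc, sup_eq_left.mpr hPA]
  rw [relIndex_map_map, inf_comm, ← sup_inf_assoc_of_le _ hPA, inf_relIndex_right, h,
    relIndex_sup_right]

/-- The Herbrand quotient of a finitely generated abelian group `A` with involution `s` is
`2 ^ (rank P - rank Q)`, where `P` is the fixed subgroup and `Q` the norm-one subgroup. -/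
lemma relIndex_div_relIndex_of_involution (s : V →* V) (hs : ∀ x, s (s x) = x) {A : Subgroup V}
    (hA : A.toIntSubmodule.FG) (hsA : A.map s ≤ A) :
    ((A.map (MonoidHom.id V * s)).relIndex (A ⊓ (MonoidHom.id V / s).ker) : ℚ) /
      (A.map (MonoidHom.id V / s)).relIndex (A ⊓ (MonoidHom.id V * s).ker) =
      2 ^ (((A ⊓ (MonoidHom.id V / s).ker).intRank : ℤ) -
        (A ⊓ (MonoidHom.id V * s).ker).intRank) := by
  set N := MonoidHom.id V * s with hN
  set D := MonoidHom.id V / s with hD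
  set P := A ⊓ D.ker
  set Q := A ⊓ N.ker
  have hP : P.toIntSubmodule.FG := fg_toIntSubmodule_mono inf_le_left hA
  have hQ : Q.toIntSubmodule.FG := fg_toIntSubmodule_mono inf_le_left hA
  have hPfix : ∀ x ∈ P, s x = x := fun x hx => (div_eq_one.mp hx.2).symm
  have hQinv : ∀ x ∈ Q, s x = x⁻¹ := fun x hx => (inv_eq_of_mul_eq_one_right hx.2).symm
  have hNA : A.map N ≤ P := by
    rintro _ ⟨x, hx, rfl⟩
    refine ⟨A.mul_mem hx (hsA ⟨x, hx, rfl⟩), ?_⟩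
    simp [hN, hD, hs, mul_comm]
  have hDA : A.map D ≤ Q := by
    rintro _ ⟨x, hx, rfl⟩
    refine ⟨A.div_mem hx (hsA ⟨x, hx, rfl⟩), ?_⟩
    simp [hN, hD, hs]
  have hPN : P.map (powMonoidHom 2) = P.map N :=
    SetLike.coe_injective <| Set.image_congr fun x hx => by simp [hN, hPfix x hx, pow_two]
  have hQD : Q.map (powMonoidHom 2) = Q.map D :=
    SetLike.coe_injective <| Set.image_congr fun x hx => by simp [hD, hQinv x hx, pow_two]
  have htors : P ⊓ (powMonoidHom 2 : V →* V).ker = Q ⊓ (powMonoidHom 2 : V →* V).ker := by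
    ext x
    constructor
    · rintro ⟨hx, hx2⟩
      refine ⟨⟨hx.1, ?_⟩, hx2⟩
      simpa [hN, hPfix x hx, pow_two] using hx2
    · rintro ⟨hx, hx2⟩
      refine ⟨⟨hx.1, ?_⟩, hx2⟩
      simpa [hD, hQinv x hx, pow_two] using hx2
  have hP2 := relIndex_map_powMonoidHom two_ne_zero hP
  have hQ2 := relIndex_map_powMonoidHom two_ne_zero hQ
  have hP0 := relIndex_map_powMonoidHom_ne_zero two_ne_zero hP
  have hQ0 := relIndex_map_powMonoidHom_ne_zero two_ne_zero hQ
  rw [hPN, ← relIndex_mul_relIndex _ _ _ (map_mono inf_le_left) hNA,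
    relIndex_map_map_of_le N inf_le_left] at hP2 hP0
  rw [hQD, ← relIndex_mul_relIndex _ _ _ (map_mono inf_le_left) hDA,
    relIndex_map_map_of_le D inf_le_left, sup_comm] at hQ2 hQ0
  rw [← htors] at hQ2
  have hk := left_ne_zero_of_mul hP0
  have hD0 := right_ne_zero_of_mul hQ0
  rw [zpow_sub₀ two_ne_zero, zpow_natCast, zpow_natCast,
    div_eq_div_iff (by exact_mod_cast hD0) (by positivity)]
  norm_cast
  refine Nat.eq_of_mul_eq_mul_left (Nat.pos_of_ne_zero hk) ?_
  rw [← mul_assoc, hP2, mul_left_comm, hQ2]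
  ring

section Pi

variable (ι : Type*)

/-- The additive version of `ι → Multiplicative ℤ` is `ι → ℤ`. -/
def additivePiMultiplicativeIntEquiv : Additive (ι → Multiplicative ℤ) ≃ₗ[ℤ] (ι → ℤ) :=
  AddEquiv.toIntLinearEquiv
    { toFun x i := (x.toMul i).toAdd
      invFun x := .ofMul fun i => .ofAdd (x i)
      map_add' _ _ := rfl }

variable [Finite ι]

lemma fg_toIntSubmodule_pi (B : Subgroup (ι → Multiplicative ℤ)) : B.toIntSubmodule.FG := by
  have := Module.Finite.equiv (additivePiMultiplicativeIntEquiv ι).symm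
  exact IsNoetherian.noetherian _

lemma intRank_top_pi : (⊤ : Subgroup (ι → Multiplicative ℤ)).intRank = Nat.card ι := by
  have := Fintype.ofFinite ι
  refine (finrank_top ℤ (Additive (ι → Multiplicative ℤ))).trans ?_
  rw [(additivePiMultiplicativeIntEquiv ι).finrank_eq, Module.finrank_fintype_fun_eq_card,
    Nat.card_eq_fintype_card]

end Pi

end Subgroup

namespace IsDedekindDomain.HeightOneSpectrum

variable {R : Type*} [CommRing R] [IsDedekindDomain R] (L : Type*) [Field L] [Algebra R L]
  [IsFractionRing R L]

lemma valuationOfNeZero_eq_one_iff (v : HeightOneSpectrum R) (x : Lˣ) :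
    v.valuationOfNeZero x = 1 ↔ v.valuation L x = 1 := by
  rw [← valuationOfNeZero_eq, ← WithZero.coe_one, WithZero.coe_inj]

/-- The `v`-adic valuations, for `v ∈ S`, of a nonzero element. -/
noncomputable def valuationsOfNeZero (S : Set (HeightOneSpectrum R)) :
    Lˣ →* (S → Multiplicative ℤ) :=
  MonoidHom.pi fun v => v.1.valuationOfNeZero

/-- The elements with trivial valuations everywhere are the units of the ring. -/
lemma unit_inf_ker_valuationsOfNeZero (S : Set (HeightOneSpectrum R)) :
    S.unit L ⊓ (valuationsOfNeZero L S).ker = (Units.map (algebraMap R L).toMonoidHom).range := by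
  ext x
  constructor
  · rintro ⟨hx, hx'⟩
    have h (v : HeightOneSpectrum R) : v.valuation L x = 1 := by
      by_cases hv : v ∈ S
      · exact (valuationOfNeZero_eq_one_iff L v x).mp (congrFun hx' ⟨v, hv⟩)
      · exact hx v hv
    obtain ⟨y, hy⟩ := mem_integers_of_valuation_le_one L (x : L) fun v => (h v).le
    obtain ⟨z, hz⟩ := mem_integers_of_valuation_le_one L ((x⁻¹ : Lˣ) : L)
      fun v : HeightOneSpectrum R => by simp [h v]
    have hyz : y * z = 1 := IsFractionRing.injective R L (by simp [hy, hz])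
    exact ⟨Units.mkOfMulEqOne y z hyz, Units.ext hy⟩
  · rintro ⟨u, rfl⟩
    have h (v : HeightOneSpectrum R) := valuation_of_unit_eq (K := L) v u
    exact ⟨fun v _ => (valuationOfNeZero_eq_one_iff L v _).mp (h v), funext fun v => h v⟩

/-- If the class group is finite, then some element is divisible by the prime `v` and by no other
prime. -/
lemma exists_mem_iff_eq [Finite (ClassGroup R)] (v : HeightOneSpectrum R) :
    ∃ a : R, a ≠ 0 ∧ ∀ w : HeightOneSpectrum R, a ∈ w.asIdeal ↔ w = v := by
  have hv : v.asIdeal ∈ nonZeroDivisors (Ideal R) := mem_nonZeroDivisors_of_ne_zero v.ne_bot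
  have h : (ClassGroup.mk0 ⟨v.asIdeal, hv⟩) ^ Nat.card (ClassGroup R) = 1 := pow_card_eq_one'
  rw [← map_pow] at h
  obtain ⟨a, ha⟩ := (ClassGroup.mk0_eq_one_iff (pow_mem hv _)).mp h
  change v.asIdeal ^ Nat.card (ClassGroup R) = Ideal.span {a} at ha
  refine ⟨a, ?_, fun w => ?_⟩
  · rintro rfl
    rw [Ideal.span_singleton_zero] at ha
    exact v.ne_bot (eq_zero_of_pow_eq_zero ha)
  · rw [← Ideal.span_singleton_le_iff_mem, ← ha, w.isPrime.pow_le_iff Nat.card_pos.ne']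
    constructor
    · exact fun h => HeightOneSpectrum.ext (v.isMaximal.eq_of_le w.isPrime.ne_top h).symm
    · rintro rfl
      exact le_rfl

lemma exists_mem_unit_valuationsOfNeZero_eq [Finite (ClassGroup R)]
    [DecidableEq (HeightOneSpectrum R)] (S : Set (HeightOneSpectrum R)) (v : S) :
    ∃ u ∈ S.unit L, ∃ z : Multiplicative ℤ,
      z ≠ 1 ∧ valuationsOfNeZero L S u = Pi.mulSingle v z := by
  obtain ⟨a, ha, h⟩ := exists_mem_iff_eq v.1
  have ha' : algebraMap R L a ≠ 0 := by simpa using ha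
  have h1 (w : HeightOneSpectrum R) (hw : w ≠ v) : w.valuation L (algebraMap R L a) = 1 := by
    rw [valuation_eq_one_iff_notMem, h]
    exact hw
  refine ⟨Units.mk0 _ ha', fun w hw => h1 w ?_, v.1.valuationOfNeZero (Units.mk0 _ ha'), ?_, ?_⟩
  · rintro rfl
    exact hw v.2
  · rw [Ne, valuationOfNeZero_eq_one_iff, Units.val_mk0, valuation_eq_one_iff_notMem, h]
    exact fun h => h rfl
  · ext w
    by_cases hw : w = v
    · subst hw
      simp [valuationsOfNeZero]
    · rw [Pi.mulSingle_eq_of_ne hw]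
      congr 1
      exact (valuationOfNeZero_eq_one_iff L w.1 _).mpr (h1 _ (Subtype.coe_injective.ne hw))

lemma intRank_map_valuationsOfNeZero [Finite (ClassGroup R)] (S : Set (HeightOneSpectrum R))
    [Finite S] : ((S.unit L).map (valuationsOfNeZero L S)).intRank = Nat.card S := by
  classical
  have := Fintype.ofFinite S
  choose u hu z hz h using exists_mem_unit_valuationsOfNeZero_eq L S
  refine le_antisymm ?_ ?_
  · rw [← Subgroup.intRank_top_pi S]
    exact Subgroup.intRank_mono le_top (Subgroup.fg_toIntSubmodule_pi _ _)
  · let d : (S → Multiplicative ℤ) →* (S → Multiplicative ℤ) :=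
      { toFun x v := z v ^ (x v).toAdd
        map_one' := by ext; simp
        map_mul' x y := by ext; simp [zpow_add] }
    have hd : Function.Injective d := by
      intro x y hxy
      ext v
      have := congrArg Multiplicative.toAdd (congrFun hxy v)
      have hzv : (z v).toAdd ≠ 0 := fun h => hz v h
      simpa [d, hzv] using this
    rw [← Subgroup.intRank_top_pi S,
      ← Subgroup.intRank_map_of_injective hd (Subgroup.fg_toIntSubmodule_pi _ _)]
    refine Subgroup.intRank_mono ?_ (Subgroup.fg_toIntSubmodule_pi _ _)
    rintro _ ⟨x, -, rfl⟩
    refine ⟨∏ v, u v ^ (x v).toAdd,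
      Subgroup.prod_mem _ fun v _ => Subgroup.zpow_mem _ (hu v) _, ?_⟩
    rw [map_prod, ← Finset.univ_prod_mulSingle (d x)]
    refine Finset.prod_congr rfl fun v _ => ?_
    rw [map_zpow, h, ← Pi.mulSingle_zpow]
    rfl

/-- If a ring isomorphism `e` extends to `f` on the fraction field, then an element whose valuation
at `e⁻¹(w)` is trivial is sent by `f` to an element with trivial valuation at `w`. -/
lemma valuation_map_eq_one (e : R ≃+* R) (f : L →+* L)
    (hf : ∀ r, f (algebraMap R L r) = algebraMap R L (e r)) (w : HeightOneSpectrum R) {x : L}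
    (hx : (w.comap (e : R →+* R) e.surjective).valuation L x = 1) : w.valuation L (f x) = 1 := by
  set v := w.comap (e : R →+* R) e.surjective
  obtain ⟨r, ⟨s, hs⟩, hsr⟩ := exists_primeCompl_mul_eq_of_integer v x hx.le
  have hr : r ∉ v.asIdeal := by
    rw [← valuation_eq_one_iff_notMem (K := L), ← hsr, map_mul, hx, one_mul,
      valuation_eq_one_iff_notMem]
    exact hs
  have hw := congrArg (w.valuation L) (congrArg f hsr)
  rwa [map_mul, hf, hf, map_mul, (valuation_eq_one_iff_notMem (v := w) (r := e r)).mpr hr,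
    (valuation_eq_one_iff_notMem (v := w) (r := e s)).mpr hs, mul_one] at hw

end IsDedekindDomain.HeightOneSpectrum

namespace NumberField

open IsDedekindDomain HeightOneSpectrum

variable (L : Type*) [Field L] [NumberField L]

lemma fg_toIntSubmodule_range_units :
    (Units.map (algebraMap (𝓞 L) L).toMonoidHom).range.toIntSubmodule.FG := by
  rw [MonoidHom.range_eq_map]
  exact Subgroup.fg_toIntSubmodule_map _ (Module.Finite.fg_top (R := ℤ) (M := Additive (𝓞 L)ˣ))

lemma intRank_range_units :
    (Units.map (algebraMap (𝓞 L) L).toMonoidHom).range.intRank = Units.rank L := by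
  rw [MonoidHom.range_eq_map, Subgroup.intRank_map_of_injective
    (Units.map_injective RingOfIntegers.coe_injective)
    (Module.Finite.fg_top (R := ℤ) (M := Additive (𝓞 L)ˣ)), ← Units.finrank_eq]
  exact finrank_top ℤ (Additive (𝓞 L)ˣ)

lemma fg_toIntSubmodule_unit (S : Set (HeightOneSpectrum (𝓞 L))) [Finite S] :
    (S.unit L).toIntSubmodule.FG :=
  Subgroup.fg_toIntSubmodule_of_map (valuationsOfNeZero L S) (Subgroup.fg_toIntSubmodule_pi _ _)
    (unit_inf_ker_valuationsOfNeZero L S ▸ fg_toIntSubmodule_range_units L)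

/-- The rank part of Dirichlet's `S`-unit theorem. -/
lemma intRank_unit_add_one (S : Set (HeightOneSpectrum (𝓞 L))) [Finite S] :
    (S.unit L).intRank + 1 = Nat.card S + Nat.card (InfinitePlace L) := by
  have : 0 < Fintype.card (InfinitePlace L) := Fintype.card_pos
  rw [← Subgroup.intRank_map_add (valuationsOfNeZero L S) (fg_toIntSubmodule_unit L S),
    intRank_map_valuationsOfNeZero, unit_inf_ker_valuationsOfNeZero, intRank_range_units,
    Units.rank, Nat.card_eq_fintype_card (α := InfinitePlace L)]
  omega

lemma valuation_algebraMap_eq_one_iff {E : Type*} [Field E] [NumberField E] [Algebra E L]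
    (v : HeightOneSpectrum (𝓞 E)) (w : HeightOneSpectrum (𝓞 L))
    (h : w.asIdeal.comap (algebraMap (𝓞 E) (𝓞 L)) = v.asIdeal) (x : E) :
    w.valuation L (algebraMap E L x) = 1 ↔ v.valuation E x = 1 := by
  have : w.asIdeal.LiesOver v.asIdeal := ⟨h.symm⟩
  rw [← HeightOneSpectrum.valuation_liesOver L v w, pow_eq_one_iff_of_nonneg zero_le]
  exact Ideal.IsDedekindDomain.ramificationIdx'_ne_zero_of_liesOver w.asIdeal v.ne_bot

end NumberField

lemma finite_SKset_s12 (E L : Type*) [Field E] [NumberField E] [Field L] [NumberField L]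
    [Algebra E L] (SF : Finset (HeightOneSpectrum (𝓞 E))) : (SKset E L SF).Finite := by
  have h : SKset E L SF =
      ⋃ v ∈ SF, {w | w.asIdeal.comap (algebraMap (𝓞 E) (𝓞 L)) = v.asIdeal} := by
    ext w
    simp [SKset]
  rw [h]
  refine SF.finite_toSet.biUnion fun v _ => ?_
  have := v.isMaximal
  have hfin := IsDedekindDomain.primesOver_finite v.asIdeal (𝓞 L)
  refine Set.Finite.of_finite_image (f := HeightOneSpectrum.asIdeal) (hfin.subset ?_)
    fun w _ w' _ => HeightOneSpectrum.ext
  rintro _ ⟨w, hw, rfl⟩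
  exact ⟨w.isPrime, ⟨hw.symm⟩⟩

lemma map_sigmaU_UKS_le (E L : Type*) [Field E] [Field L] [NumberField L] [Algebra E L]
    (σ : L ≃ₐ[E] L) (SF : Finset (HeightOneSpectrum (𝓞 E))) :
    (UKS E L SF).map (sigmaU E L σ) ≤ UKS E L SF := by
  rintro _ ⟨x, hx, rfl⟩ w hw
  let e : 𝓞 L ≃+* 𝓞 L := RingOfIntegers.mapRingEquiv σ
  refine HeightOneSpectrum.valuation_map_eq_one L e σ.toAlgHom.toRingHom (fun _ => rfl) w (hx _ ?_)
  rintro ⟨v, hv, h⟩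
  refine hw ⟨v, hv, h ▸ ?_⟩
  ext r
  have : e (algebraMap (𝓞 E) (𝓞 L) r) = algebraMap (𝓞 E) (𝓞 L) r :=
    RingOfIntegers.ext (σ.commutes (r : E))
  change _ ↔ e (algebraMap (𝓞 E) (𝓞 L) r) ∈ w.asIdeal
  rw [this]
  rfl

lemma map_unit_eq_UFS (SF : Finset (HeightOneSpectrum (𝓞 F))) :
    ((SF : Set (HeightOneSpectrum (𝓞 F))).unit F).map (Units.map (algebraMap F K).toMonoidHom) =
      UFS F K SF := by
  ext y
  constructor
  · rintro ⟨x, hx, rfl⟩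
    refine ⟨fun w hw => ?_, fun τ => Units.ext (τ.commutes x)⟩
    refine (valuation_algebraMap_eq_one_iff K (w.under (𝓞 F)) w rfl x).mpr (hx _ fun h => ?_)
    exact hw ⟨_, h, rfl⟩
  · rintro ⟨hy, hfix⟩
    obtain ⟨x, hx⟩ := (IsGalois.mem_range_algebraMap_iff_fixed (F := F) (y : K)).mpr
      fun τ => congrArg Units.val (hfix τ)
    have hx0 : x ≠ 0 := by
      rintro rfl
      exact y.ne_zero (by rw [← hx, map_zero])
    refine ⟨Units.mk0 x hx0, fun v hv => ?_, Units.ext hx⟩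
    have := v.isMaximal
    obtain ⟨P, hPm, hP⟩ :=
      Ideal.exists_maximal_ideal_liesOver_of_isIntegral (S := 𝓞 K) v.asIdeal
    let w : HeightOneSpectrum (𝓞 K) :=
      ⟨P, hPm.isPrime, Ideal.ne_bot_of_liesOver_of_ne_bot v.ne_bot P⟩
    have hw : w.asIdeal.comap (algebraMap (𝓞 F) (𝓞 K)) = v.asIdeal := hP.over.symm
    refine (valuation_algebraMap_eq_one_iff K v w hw x).mp (hx ▸ hy w ?_)
    rintro ⟨v', hv', h⟩
    exact hv (HeightOneSpectrum.ext (hw.symm.trans h) ▸ hv')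

lemma fixedU_eq_ker_oneSubU (hd : Module.finrank F K = 2) (σ : K ≃ₐ[F] K)
    (hσ : σ ≠ AlgEquiv.refl) : fixedU F K = (oneSubU F K σ).ker := by
  rw [← IsGalois.card_aut_eq_finrank, Nat.card_eq_two_iff' (AlgEquiv.refl : K ≃ₐ[F] K)] at hd
  ext x
  constructor
  · exact fun hx => div_eq_one.mpr (hx σ).symm
  · intro hx τ
    by_cases hτ : τ = AlgEquiv.refl
    · rw [hτ]
      rfl
    · rw [hd.unique hτ hσ]
      exact (div_eq_one.mp hx).symm

/-- For a quadratic extension `K/F` of number fields with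
`Gal(K/F) = {1, σ}`, the Herbrand quotient `h(G, U_{K,S}) = 2^{2#S_F - #S_K - 1}`. -/
theorem herbrand_sunits_eq_two_zpow
    (hd : Module.finrank F K = 2) (σ : K ≃ₐ[F] K) (hσ : σ ≠ AlgEquiv.refl)
    (SF : Finset (HeightOneSpectrum (𝓞 F))) :
    herbrandU F K σ SF = (2 : ℚ) ^ (2 * (nSF F SF : ℤ) - (nSK F K SF : ℤ) - 1) := by
  have hA : (UKS F K SF).toIntSubmodule.FG :=
    have := (finite_SKset_s12 F K SF).to_subtype
    fg_toIntSubmodule_unit K (SKset F K SF)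
  have hAK : (UKS F K SF).intRank + 1 = nSK F K SF :=
    have := (finite_SKset_s12 F K SF).to_subtype
    intRank_unit_add_one K (SKset F K SF)
  have hAF : (UFS F K SF).intRank + 1 = nSF F SF := by
    rw [← map_unit_eq_UFS, Subgroup.intRank_map_of_injective
      (Units.map_injective (algebraMap F K).injective) (fg_toIntSubmodule_unit F _),
      intRank_unit_add_one]
    simp [nSF]
  have hs (x : Kˣ) : sigmaU F K σ (sigmaU F K σ x) = x := by
    have h : σ ^ 2 = 1 := by
      rw [← hd, ← IsGalois.card_aut_eq_finrank]
      exact pow_card_eq_one'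
    exact Units.ext (DFunLike.congr_fun h (x : K))
  have hsA := map_sigmaU_UKS_le F K σ SF
  have hP : UFS F K SF = UKS F K SF ⊓ (oneSubU F K σ).ker := by
    rw [UFS, fixedU_eq_ker_oneSubU F K hd σ hσ]
  have hrank := Subgroup.intRank_add_intRank_of_involution _ hs hA hsA
  have hquot := Subgroup.relIndex_div_relIndex_of_involution _ hs hA hsA
  change (UKS F K SF ⊓ (oneSubU F K σ).ker).intRank + (UKSminus F K σ SF).intRank = _ at hrank
  change ((NUKS F K σ SF).relIndex (UKS F K SF ⊓ (oneSubU F K σ).ker) : ℚ) /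
    ((UKS F K SF).map (oneSubU F K σ)).relIndex (UKSminus F K σ SF) =
    2 ^ (((UKS F K SF ⊓ (oneSubU F K σ).ker).intRank : ℤ) - (UKSminus F K σ SF).intRank) at hquot
  rw [← hP] at hrank hquot
  refine Eq.trans hquot ?_
  congr 1
  omega
end
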